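/- For every real number z with 0 < z < 4/27, setting α = (1/3)·arcsin(√(27z/4)), one has Σ_{n≥0} C(3n,n)·(2/(n+1)) · zⁿ = (12·cos²α + 6)/(4·cos²α − 1)². -/

import Mathlib

theorem aux_desc (m : ℕ) : (descPochhammer ℝ m).eval (-3) = (-1)^m * ((m+2).factorial : ℝ) / 2 := by
  induction m with
  | zero => simp
  | succ m ih => 
    rw [descPochhammer_succ_eval, ih, Nat.factorial_succ (m+2)]
    push_cast; ring

theorem aux_diff (m : ℕ) : ∑ j ∈ Finset.range (m+1), (-1:ℝ)^(m-j) * ((m+1).choose (j+1) : ℝ) * ((3*j).choose m : ℝ) * (m.factorial : ℝ) = ((m+2).factorial : ℝ)/2 := by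
  have hdeg : ((descPochhammer ℝ m).comp (3 * Polynomial.X - 3)).natDegree < m + 1 := by
    rw [Polynomial.natDegree_comp, descPochhammer_natDegree]
    have : (3 * Polynomial.X - 3 : Polynomial ℝ).natDegree ≤ 1 := by compute_degree
    nlinarith
  have h := congrFun (Polynomial.fwdDiff_iter_eq_zero_of_degree_lt hdeg) 0
  rw [fwdDiff_iter_eq_sum_shift, Finset.sum_range_succ'] at h
  simp only [Polynomial.eval_comp, Polynomial.eval_sub, Polynomial.eval_mul, Polynomial.eval_ofNat, Polynomial.eval_X, Pi.zero_apply, zero_add, nsmul_eq_mul, mul_one, zsmul_eq_mul, Nat.cast_zero, mul_zero, zero_sub, aux_desc] at h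
  have h2 : ∀ j : ℕ, (descPochhammer ℝ m).eval (3 * ((j+1 : ℕ) : ℝ) - 3) = ((3*j).choose m : ℝ) * (m.factorial : ℝ) := by
    intro j
    have : (3 * ((j+1 : ℕ) : ℝ) - 3) = ((3 * j : ℕ) : ℝ) := by push_cast; ring
    rw [this, descPochhammer_eval_eq_descFactorial, Nat.descFactorial_eq_factorial_mul_choose]
    push_cast; ring
  simp only [h2] at h
  push_cast at h
  have e : (-1:ℝ)^(m+1) * ((m+1).choose 0 : ℝ) * ((-1)^m * ((m+2).factorial : ℝ)/2) = - (((m+2).factorial : ℝ)/2) := by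
    have : (-1:ℝ)^m * (-1)^m = 1 := by rw [← mul_pow]; simp
    rw [Nat.choose_zero_right, pow_succ]
    push_cast
    linear_combination (-((m+2).factorial : ℝ)/2) * this
  rw [e] at h
  rw [← sub_eq_zero, sub_eq_add_neg, ← h]
  congr 1
  refine Finset.sum_congr rfl fun j hj => ?_
  ring

theorem aux_coef (m : ℕ) : ∑ p ∈ Finset.HasAntidiagonal.antidiagonal m, ((3*p.1).choose p.1 : ℝ) * (2/(p.1+1)) * ((-1)^p.2 * ((2*p.1).choose p.2 : ℝ)) = m + 2 := by
  rw [Finset.Nat.sum_antidiagonal_eq_sum_range_succ_mk]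
  have h := aux_diff m
  have hm : (m.factorial : ℝ) ≠ 0 := by positivity
  have hm1 : (m + 1 : ℝ) ≠ 0 := by positivity
  rw [← Finset.sum_mul] at h
  have h3 : ((m+2).factorial : ℝ) = (m+2)*(m+1)*m.factorial := by
    rw [Nat.factorial_succ, Nat.factorial_succ]; push_cast; ring
  have h4 : ∑ j ∈ Finset.range (m+1), (-1:ℝ)^(m-j) * ((m+1).choose (j+1) : ℝ) * ((3*j).choose m : ℝ) = (m+2)*(m+1)/2 := by
    apply mul_right_cancel₀ hm
    rw [h, h3]; ring
  have h5 : (m + 2 : ℝ) = 2/(m+1) * ((m+2)*(m+1)/2) := by field_simp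
  rw [h5, ← h4, Finset.mul_sum]
  refine Finset.sum_congr rfl fun n hn => ?_
  have hn' : n ≤ m := by simpa [Nat.lt_succ_iff] using hn
  have a1 : ((3*n).choose m : ℝ) * (m.choose n : ℝ) = ((3*n).choose n : ℝ) * ((2*n).choose (m-n) : ℝ) := by
    have := Nat.choose_mul (n := 3*n) (k := m) (s := n) hn'
    rw [show 3*n-n = 2*n by omega] at this
    exact_mod_cast this
  have a2 : ((m+1 : ℝ)) * (m.choose n : ℝ) = ((m+1).choose (n+1) : ℝ) * (n+1) := by
    exact_mod_cast Nat.add_one_mul_choose_eq m n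
  have hn1 : (n + 1 : ℝ) ≠ 0 := by positivity
  simp only
  field_simp
  linear_combination (-(m+1:ℝ)) * a1 + ((3*n).choose m : ℝ) * a2

noncomputable def auxC (n : ℕ) : ℝ := ((3*n).choose n : ℝ) * (2/(n+1))

theorem auxC_nonneg (n : ℕ) : 0 ≤ auxC n := by unfold auxC; positivity

theorem auxC_bound (n : ℕ) : auxC n * (4/27)^n ≤ 2 := by
  have h : ((3*n).choose n : ℝ) * (4/27)^n ≤ 1 := by
    have h1 := add_pow (1/3 : ℝ) (2/3) (3*n)
    have h2 := Finset.single_le_sum (f := fun m => (1/3:ℝ)^m * (2/3)^(3*n-m) * ((3*n).choose m : ℝ)) (s := Finset.range (3*n+1)) (fun i _ => by positivity) (Finset.mem_range.2 (show n < 3*n+1 by omega))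
    rw [← h1, show 3*n-n = 2*n by omega, pow_mul, ← mul_pow] at h2
    norm_num at h2
    linarith
  have h3 : (2/(n+1) : ℝ) ≤ 2 := by
    rw [div_le_iff₀ (by positivity)]
    have : (0:ℝ) ≤ n := by positivity
    linarith
  unfold auxC
  have h0 : (0:ℝ) ≤ ((3*n).choose n : ℝ) * (4/27)^n := by positivity
  have h4 : (0:ℝ) ≤ 2/(n+1) := by positivity
  nlinarith

noncomputable def auxP : FormalMultilinearSeries ℝ ℝ ℝ := FormalMultilinearSeries.ofScalars ℝ auxC

theorem auxP_radius : ((4/27 : NNReal) : ENNReal) ≤ auxP.radius := by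
  apply FormalMultilinearSeries.le_radius_of_bound _ 2
  intro n
  rw [auxP, FormalMultilinearSeries.ofScalars_norm, Real.norm_of_nonneg (auxC_nonneg n)]
  simpa using auxC_bound n

theorem auxP_ball : HasFPowerSeriesOnBall auxP.sum auxP 0 ((4/27 : NNReal) : ENNReal) :=
  (auxP.hasFPowerSeriesOnBall (lt_of_lt_of_le (by norm_num) auxP_radius)).mono (by norm_num) auxP_radius

theorem aux_mem {x : ℝ} (hx : |x| < 4/27) : x ∈ Metric.eball (0:ℝ) ((4/27 : NNReal) : ENNReal) := by
  rw [Metric.eball_coe]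
  simpa using hx

theorem auxP_hasSum {x : ℝ} (hx : |x| < 4/27) : HasSum (fun n => auxC n * x^n) (auxP.sum x) := by
  have := auxP_ball.hasSum (aux_mem hx)
  simpa [auxP, FormalMultilinearSeries.ofScalars_apply_eq, mul_comm] using this

theorem auxP_analytic {x : ℝ} (hx : |x| < 4/27) : AnalyticAt ℝ auxP.sum x :=
  auxP_ball.analyticOnNhd x (aux_mem hx)

theorem aux_binom (x : ℝ) (N : ℕ) : HasSum (fun k => (N.choose k : ℝ) * x^k) ((1+x)^N) := by
  have : (1+x)^N = ∑ k ∈ Finset.range (N+1), (N.choose k : ℝ) * x^k := by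
    rw [add_comm, add_pow]
    exact Finset.sum_congr rfl fun k _ => by simp [mul_comm]
  rw [this]
  apply hasSum_sum_of_ne_finset_zero
  intro k hk
  rw [Nat.choose_eq_zero_of_lt (by simpa using hk)]
  simp

theorem aux_local {w : ℝ} (hw : |w| < 1/10) : auxP.sum (w*(1-w)^2) = 1/(1-w) + 1/(1-w)^2 := by
  have hw0 := abs_nonneg w
  obtain ⟨hwl, hwr⟩ := abs_lt.1 hw
  let f : ℕ × ℕ → ℝ := fun p => auxC p.1 * w^p.1 * (((2*p.1).choose p.2 : ℝ) * (-w)^p.2)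
  have hz : |w*(1-w)^2| < 4/27 := by
    rw [abs_mul, abs_of_nonneg (sq_nonneg (1-w))]
    nlinarith
  have hz' : |(|w| * (1+|w|)^2)| < 4/27 := by
    rw [abs_of_nonneg (by positivity)]
    nlinarith
  have hfa : ∀ n k, ‖f (n,k)‖ = auxC n * |w|^n * (((2*n).choose k : ℝ) * |w|^k) := by
    intro n k
    simp [f, abs_of_nonneg (auxC_nonneg n)]
  have hrow : ∀ n, HasSum (fun k => ‖f (n,k)‖) (auxC n * (|w| * (1+|w|)^2)^n) := by
    intro n
    simp only [hfa]
    have e : auxC n * (|w| * (1+|w|)^2)^n = auxC n * |w|^n * (1+|w|)^(2*n) := by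
      rw [mul_pow, ← pow_mul]; ring
    rw [e]
    exact (aux_binom |w| (2*n)).mul_left (auxC n * |w|^n)
  have hsum : Summable f := by
    apply Summable.of_norm
    rw [summable_prod_of_nonneg (fun _ => norm_nonneg _)]
    refine ⟨fun n => (hrow n).summable, ?_⟩
    simp only [(hrow _).tsum_eq]
    exact (auxP_hasSum hz').summable
  have h1 : HasSum (fun n => auxC n * (w*(1-w)^2)^n) (∑' p, f p) := by
    refine hsum.hasSum.prod_fiberwise fun n => ?_
    have e : auxC n * (w*(1-w)^2)^n = auxC n * w^n * (1+(-w))^(2*n) := by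
      rw [mul_pow, ← pow_mul]; ring
    rw [e]
    exact (aux_binom (-w) (2*n)).mul_left (auxC n * w^n)
  have h2 : HasSum (fun m : ℕ => ((m:ℝ) + 2) * w^m) (∑' p, f p) := by
    have := (Finset.HasAntidiagonal.sigmaAntidiagonalEquivProd.hasSum_iff (f := f)).2 hsum.hasSum
    refine this.sigma fun m => ?_
    convert hasSum_fintype _ using 1
    rw [← aux_coef m, Finset.sum_mul]
    rw [← Finset.sum_coe_sort]
    refine Finset.sum_congr rfl fun p _ => ?_
    have hp : p.1.1 + p.1.2 = m := Finset.HasAntidiagonal.mem_antidiagonal.1 p.2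
    simp only [f, Function.comp, Finset.HasAntidiagonal.sigmaAntidiagonalEquivProd_apply, auxC]
    have hp' : w^m = w^p.1.1 * w^p.1.2 := by rw [← pow_add, hp]
    rw [neg_pow w, hp']
    ring
  have hw1 : ‖w‖ < 1 := by rw [Real.norm_eq_abs]; linarith
  have h3 : HasSum (fun m : ℕ => ((m:ℝ) + 2) * w^m) (w/(1-w)^2 + 2 * (1-w)⁻¹) := by
    simp only [add_mul]
    exact (hasSum_coe_mul_geometric_of_norm_lt_one hw1).add ((hasSum_geometric_of_norm_lt_one hw1).mul_left 2)
  rw [(auxP_hasSum hz).unique h1, h2.unique h3]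
  have : 1 - w ≠ 0 := by linarith
  field_simp
  ring

theorem aux_global {w : ℝ} (h0 : 0 < w) (h1 : w < 1/3) :
    |w*(1-w)^2| < 4/27 ∧ auxP.sum (w*(1-w)^2) = 1/(1-w) + 1/(1-w)^2 := by
  have hz : ∀ w ∈ Set.Ioo (-1/10 : ℝ) (1/3), |w*(1-w)^2| < 4/27 := by
    rintro w ⟨h0, h1⟩
    rw [abs_lt]
    constructor
    · nlinarith [sq_nonneg w, sq_nonneg (1-w)]
    · have : 4/27 - w*(1-w)^2 = (1-3*w)^2*(4-3*w)/27 := by ring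
      have : 0 < (1-3*w)^2*(4-3*w)/27 := by
        have : 0 < 1-3*w := by linarith
        have : 0 < 4-3*w := by linarith
        positivity
      linarith
  have hw : w ∈ Set.Ioo (-1/10 : ℝ) (1/3) := ⟨by linarith, h1⟩
  refine ⟨hz w hw, ?_⟩
  have hA : AnalyticOnNhd ℝ (fun w => auxP.sum (w*(1-w)^2)) (Set.Ioo (-1/10 : ℝ) (1/3)) := by
    intro x hx
    exact AnalyticAt.fun_comp (f := fun w : ℝ => w*(1-w)^2) (auxP_analytic (hz x hx)) (by fun_prop)
  have hB : AnalyticOnNhd ℝ (fun w : ℝ => 1/(1-w) + 1/(1-w)^2) (Set.Ioo (-1/10 : ℝ) (1/3)) := by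
    intro x hx
    have : 1 - x ≠ 0 := by have := hx.2; intro h; linarith
    have h2 : (1 - x)^2 ≠ 0 := pow_ne_zero _ this
    fun_prop (disch := assumption)
  refine hA.eqOn_of_preconnected_of_eventuallyEq hB isPreconnected_Ioo (z₀ := 0) ⟨by norm_num, by norm_num⟩ ?_ hw
  filter_upwards [Metric.ball_mem_nhds (0:ℝ) (show (0:ℝ) < 1/10 by norm_num)] with x hx
  exact aux_local (by simpa using hx)

theorem stmt_5 (z : ℝ) (hz0 : 0 < z) (hz1 : z < 4 / 27) :
    HasSum (fun n : ℕ => (Nat.choose (3 * n) n : ℝ) * (2 / (n + 1)) * z ^ n)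
      ((12 * Real.cos ((1 / 3) * Real.arcsin (Real.sqrt (27 * z / 4))) ^ 2 + 6) /
        (4 * Real.cos ((1 / 3) * Real.arcsin (Real.sqrt (27 * z / 4))) ^ 2 - 1) ^ 2) := by
  set x := Real.sqrt (27 * z / 4) with hx
  have hx0 : 0 < x := Real.sqrt_pos.2 (by linarith)
  have hx2 : x^2 = 27*z/4 := Real.sq_sqrt (by linarith)
  have hx1 : x < 1 := by nlinarith
  set a := (1/3) * Real.arcsin x with ha
  have ha0 : 0 < a := by have := Real.arcsin_pos.2 hx0; positivity
  have ha1 : a < Real.pi/6 := by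
    have := Real.arcsin_lt_pi_div_two.2 hx1
    linarith
  have hpi := Real.pi_pos
  have hs3 : Real.sin (3*a) = x := by
    rw [show 3*a = Real.arcsin x by rw [ha]; ring]
    exact Real.sin_arcsin (by linarith) hx1.le
  rw [Real.sin_three_mul] at hs3
  have hs0 : 0 < Real.sin a := Real.sin_pos_of_pos_of_lt_pi ha0 (by linarith)
  have hs1 : Real.sin a < 1/2 := by
    rw [← Real.sin_pi_div_six]
    exact Real.sin_lt_sin_of_lt_of_le_pi_div_two (by linarith) (by linarith) ha1
  have hc : Real.cos a ^ 2 = 1 - Real.sin a ^ 2 := Real.cos_sq' a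
  rw [hc]
  set s := Real.sin a
  obtain ⟨hz, he⟩ := aux_global (w := 4*s^2/3) (by positivity) (by nlinarith)
  have hzw : 4*s^2/3*(1-4*s^2/3)^2 = z := by
    have : z = 4/27 * x^2 := by rw [hx2]; ring
    rw [this, ← hs3]; ring
  rw [hzw] at hz he
  have h := auxP_hasSum hz
  rw [he] at h
  have h3 : (3 - 4*s^2) ≠ 0 := by nlinarith
  have e : (12 * (1-s^2) + 6)/(4*(1-s^2)-1)^2 = 1/(1-4*s^2/3) + 1/(1-4*s^2/3)^2 := by
    rw [show 4*(1-s^2)-1 = 3-4*s^2 by ring, show 1-4*s^2/3 = (3-4*s^2)/3 by ring]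
    field_simp
    ring
  rw [e]
  exact h
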